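/- arXiv:2107.05296 — 2 statements merged into one kernel-verified Lean document; each statement's English description precedes it below -/
import Mathlib

section
/- Let T = (V,E) be a finite complete rooted binary tree, p a prime, X ⊆ Y ⊆ V, and ρ : X → Z/pZ a consistent function. Let Z ⊆ cl(Y) be the set of all elements of cl(Y) that are free over ρ, and let σ : Z → Z/pZ be the function that is identically zero. Then the function ρ ∪ σ on X ∪ Z (equal to ρ on X and to 0 on Z \ X) is consistent. -/
/-!
Vertices of the complete rooted binary tree of height `n` are modelled as
binary strings (lists of booleans) of length at most `n`: the root is the empty
list, and the two children of a vertex `x` (when `x.length < n`) are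
`x ++ [true]` and `x ++ [false]`.  Leaves are the strings of length exactly `n`
and the height of a vertex is its distance to the leaves below it.
-/

/-- The ambient type of tree vertices: binary strings. -/
abbrev V : Type := List Bool

/-- The vertex set of the complete binary tree of height `n`. -/
def treeSet (n : ℕ) : Set V := {l : V | l.length ≤ n}

/-- The height of a vertex: its distance to the leaves below it. -/
def hgt (n : ℕ) (v : V) : ℕ := n - v.length

/-- A set `X` is closed if, whenever two elements of a related triple
(a parent together with its two children) belong to `X`, so does the third. -/
def TripleClosed (n : ℕ) (X : Set V) : Prop :=
  ∀ x : V, x.length < n →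
    ((x ∈ X → x ++ [true] ∈ X → x ++ [false] ∈ X) ∧
     (x ∈ X → x ++ [false] ∈ X → x ++ [true] ∈ X) ∧
     (x ++ [true] ∈ X → x ++ [false] ∈ X → x ∈ X))

/-- The closure of `X`: the smallest closed subset of the tree containing `X`. -/
def cl (n : ℕ) (X : Set V) : Set V :=
  ⋂₀ {Y : Set V | X ⊆ Y ∧ Y ⊆ treeSet n ∧ TripleClosed n Y}

/-- `min-h(X)`: the minimum height of an element of `X`. -/
noncomputable def minh (n : ℕ) (X : Set V) : ℕ := sInf (hgt n '' X)

/-- `z` lies on the unique undirected path between `x` and `y`: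
`z` is an ancestor of `x` or of `y`, and the longest common prefix of
`x` and `y` is an ancestor of `z`. -/
def OnPath (x y z : V) : Prop :=
  (z <+: x ∨ z <+: y) ∧ ∀ w : V, w <+: x → w <+: y → w <+: z

/-- `X` is connected: it contains the undirected path between any two of its elements. -/
def Conn (X : Set V) : Prop :=
  ∀ x ∈ X, ∀ y ∈ X, ∀ z : V, OnPath x y z → z ∈ X

/-- `F` encloses `v`: every path from `v` down to a leaf contains an element of `F`. -/
def Encloses (n : ℕ) (F : Set V) (v : V) : Prop :=
  ∀ l : V, l.length = n → v <+: l → ∃ z ∈ F, v <+: z ∧ z <+: l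

/-- `F` minimally encloses `v`. -/
def MinEncloses (n : ℕ) (F : Set V) (v : V) : Prop :=
  Encloses n F v ∧ ∀ F' : Set V, F' ⊂ F → ¬ Encloses n F' v

/-- `r` is the head of `X`: an element of `X` of maximum height. -/
def IsHead (n : ℕ) (X : Set V) (r : V) : Prop :=
  r ∈ X ∧ ∀ y ∈ X, hgt n y ≤ hgt n r

/-- `Fr` is the frontier of the closed connected set `S` with head `x`:
`Fr ⊆ S` minimally encloses `x` and `S` consists exactly of the vertices lying
on the directed path from `x` to some element of `Fr`. -/
def IsFrontier (n : ℕ) (S Fr : Set V) (x : V) : Prop :=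
  Fr ⊆ S ∧ MinEncloses n Fr x ∧ S = {z : V | ∃ f ∈ Fr, x <+: z ∧ z <+: f}

/-- `ρ` is consistent on a closed set `X`: `ρ(x) = ρ(y) + ρ(z)` whenever
`x, y, z ∈ X` and `y, z` are the two children of `x`. -/
def ConsistentOn (p : ℕ) (X : Set V) (ρ : V → ZMod p) : Prop :=
  ∀ x : V, x ∈ X → x ++ [true] ∈ X → x ++ [false] ∈ X →
    ρ x = ρ (x ++ [true]) + ρ (x ++ [false])

/-- `ρ` (viewed as a function with domain `X`) is consistent: it has a
consistent extension to the closure of `X`. -/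
def Consistent (n p : ℕ) (X : Set V) (ρ : V → ZMod p) : Prop :=
  ∃ ρ' : V → ZMod p, ConsistentOn p (cl n X) ρ' ∧ ∀ x ∈ X, ρ' x = ρ x

/-- Given `X ⊆ Y` and a consistent `ρ : X → Z/pZ`, an element `y ∈ cl(Y)` is
free over `ρ` if for every closed connected `S ⊆ cl(Y)` with head `x` and
frontier `F` such that `y ∈ F ∪ {x}`: either `ρ(z) = 0` for every
`z ∈ X ∩ (F ∪ {x})`, or there is `w ∈ S ∩ X` with `w ∉ F ∪ {x}`. -/
def FreeOver (n p : ℕ) (X Y : Set V) (ρ : V → ZMod p) (y : V) : Prop :=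
  ∀ S x F, S ⊆ cl n Y → S.Nonempty → TripleClosed n S → Conn S →
    IsHead n S x → IsFrontier n S F x → y ∈ insert x F →
    (∀ z ∈ X ∩ insert x F, ρ z = 0) ∨ (∃ w ∈ S ∩ X, w ∉ insert x F)

/-- A function prescribed on a set `D` that contains every vertex whose two children it contains,
and additive wherever both children lie in `D`, extends to an additive function everywhere. -/
theorem exists_additive_extension {A : Type*} [AddCommGroup A] (D : Set V) (d : V → A)
    (h : ∀ x : V, x ++ [true] ∈ D → x ++ [false] ∈ D →
      x ∈ D ∧ d x = d (x ++ [true]) + d (x ++ [false])) :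
    ∃ f : V → A, (∀ x : V, f x = f (x ++ [true]) + f (x ++ [false])) ∧ ∀ x ∈ D, f x = d x := by
  classical
  let e : List Bool → A := fun r => List.rec (d [])
    (fun b r v => if r.reverse ++ [b] ∈ D then d (r.reverse ++ [b])
      else if r.reverse ++ [!b] ∈ D then v - d (r.reverse ++ [!b])
      else if b then v else 0) r
  have he : ∀ (x : V) (b : Bool), e (x ++ [b]).reverse =
      if x ++ [b] ∈ D then d (x ++ [b])
      else if x ++ [!b] ∈ D then e x.reverse - d (x ++ [!b])
      else if b then e x.reverse else 0 := by
    intro x b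
    rw [List.reverse_append, List.reverse_singleton, List.singleton_append]
    simp only [e, List.reverse_reverse]
  have hD : ∀ x ∈ D, e x.reverse = d x := by
    intro x hx
    rcases List.eq_nil_or_concat x with rfl | ⟨y, b, rfl⟩
    · rfl
    · rw [List.concat_eq_append] at hx ⊢
      rw [he, if_pos hx]
  refine ⟨fun x => e x.reverse, fun x => ?_, hD⟩
  simp only [he]
  by_cases ht : x ++ [true] ∈ D <;> by_cases hf : x ++ [false] ∈ D
  · obtain ⟨hx, hs⟩ := h x ht hf
    simp [ht, hf, hD x hx, hs]
  · simp [ht, hf]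
  · simp [ht, hf]
  · simp [ht, hf]

theorem subset_cl (n : ℕ) (X : Set V) : X ⊆ cl n X :=
  Set.subset_sInter fun _ h => h.1

theorem cl_subset_treeSet {n : ℕ} {X : Set V} (hX : X ⊆ treeSet n) : cl n X ⊆ treeSet n := by
  refine Set.sInter_subset_of_mem ⟨hX, subset_rfl, fun x hx => ?_⟩
  simp only [treeSet, Set.mem_ofPred_eq, List.length_append, List.length_singleton]
  omega

theorem tripleClosed_cl (n : ℕ) (X : Set V) : TripleClosed n (cl n X) := fun x hx =>
  ⟨fun h₁ h₂ Y hY => (hY.2.2 x hx).1 (h₁ Y hY) (h₂ Y hY),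
   fun h₁ h₂ Y hY => (hY.2.2 x hx).2.1 (h₁ Y hY) (h₂ Y hY),
   fun h₁ h₂ Y hY => (hY.2.2 x hx).2.2 (h₁ Y hY) (h₂ Y hY)⟩

theorem append_singleton_prefix_of_ne {x l : V} (h : x <+: l) (hne : x ≠ l) :
    ∃ b : Bool, x ++ [b] <+: l := by
  obtain ⟨r, rfl⟩ := h
  cases r with
  | nil => simp at hne
  | cons b r => exact ⟨b, r, by simp⟩

theorem prefix_or_eq_append_singleton {x z : V} {b : Bool} (h : x <+: z ++ [b]) :
    x <+: z ∨ x = z ++ [b] := by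
  rcases List.prefix_concat_iff.1 (by simpa using h) with h | h
  · exact Or.inr (by simpa using h)
  · exact Or.inl h

theorem eq_of_append_singleton_prefix {x l : V} {b c : Bool} (h : x ++ [b] <+: l)
    (h' : x ++ [c] <+: l) : b = c := by
  have := (List.prefix_of_prefix_length_le h h' (by simp)).eq_of_length (by simp)
  simpa using this

theorem not_append_singleton_prefix (x : V) (b : Bool) : ¬ x ++ [b] <+: x := fun h => by
  have := h.length_le
  simp at this

theorem exists_leaf_extending {n : ℕ} {x : V} (hx : x.length ≤ n) :
    ∃ l : V, l.length = n ∧ x <+: l :=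
  ⟨x ++ List.replicate (n - x.length) true, by simp; omega, List.prefix_append _ _⟩

/-- `Splitting N W g x F s`: the vertex `x` can be split repeatedly into children, splitting only
vertices of `N` and ending with the set `F ⊆ W`, over which `g` sums to `s`. -/
inductive Splitting {A : Type*} [AddCommGroup A] (N W : Set V) (g : V → A) :
    V → Set V → A → Prop
  | leaf {x : V} (hx : x ∈ W) : Splitting N W g x {x} (g x)
  | node {x : V} {F₁ F₂ : Set V} {s₁ s₂ : A} (hx : x ∈ N)
      (h₁ : Splitting N W g (x ++ [true]) F₁ s₁)
      (h₂ : Splitting N W g (x ++ [false]) F₂ s₂) : Splitting N W g x (F₁ ∪ F₂) (s₁ + s₂)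

namespace Splitting

variable {A : Type*} [AddCommGroup A] {N W : Set V} {g : V → A} {x : V} {F : Set V} {s : A}

theorem mono {N' : Set V} (h : Splitting N W g x F s) (hN : N ⊆ N') :
    Splitting N' W g x F s := by
  induction h with
  | leaf hx => exact leaf hx
  | node hx _ _ ih₁ ih₂ => exact node (hN hx) ih₁ ih₂

theorem subset (h : Splitting N W g x F s) : F ⊆ W := by
  induction h with
  | leaf hx => exact Set.singleton_subset_iff.2 hx
  | node _ _ _ ih₁ ih₂ => exact Set.union_subset ih₁ ih₂

theorem nonempty (h : Splitting N W g x F s) : F.Nonempty := by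
  induction h with
  | leaf _ => exact Set.singleton_nonempty _
  | node _ _ _ ih₁ _ => exact ih₁.inl

theorem prefix_of_mem (h : Splitting N W g x F s) : ∀ f ∈ F, x <+: f := by
  induction h with
  | leaf _ => rintro f rfl; exact List.prefix_refl _
  | node _ _ _ ih₁ ih₂ =>
    rintro f (hf | hf)
    · exact (List.prefix_append _ _).trans (ih₁ f hf)
    · exact (List.prefix_append _ _).trans (ih₂ f hf)

theorem antichain (h : Splitting N W g x F s) : ∀ f ∈ F, ∀ f' ∈ F, f <+: f' → f = f' := by
  induction h with
  | leaf _ => rintro f rfl f' rfl _; rfl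
  | node _ h₁ h₂ ih₁ ih₂ =>
    rintro f (hf | hf) f' (hf' | hf') hff
    · exact ih₁ f hf f' hf' hff
    · cases eq_of_append_singleton_prefix ((h₁.prefix_of_mem f hf).trans hff)
        (h₂.prefix_of_mem f' hf')
    · cases eq_of_append_singleton_prefix ((h₂.prefix_of_mem f hf).trans hff)
        (h₁.prefix_of_mem f' hf')
    · exact ih₂ f hf f' hf' hff

theorem sum_eq_zero (h : Splitting N W g x F s) (h0 : ∀ f ∈ F, g f = 0) : s = 0 := by
  induction h with
  | leaf _ => exact h0 _ rfl
  | node _ _ _ ih₁ ih₂ =>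
    rw [ih₁ fun f hf => h0 f (Or.inl hf), ih₂ fun f hf => h0 f (Or.inr hf), add_zero]

theorem head_mem {n : ℕ} {C : Set V} (hC : TripleClosed n C) (hCn : C ⊆ treeSet n)
    (h : Splitting N W g x F s) (hF : F ⊆ C) : x ∈ C := by
  induction h with
  | leaf _ => exact hF rfl
  | @node x _ _ _ _ _ _ _ ih₁ ih₂ =>
    have m₁ := ih₁ (Set.subset_union_left.trans hF)
    have m₂ := ih₂ (Set.subset_union_right.trans hF)
    have hl : (x ++ [true]).length ≤ n := hCn m₁
    rw [List.length_append, List.length_singleton] at hl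
    exact (hC x hl).2.2 m₁ m₂

theorem sum_eq {n p : ℕ} {C : Set V} {g g' : V → ZMod p} {s : ZMod p} (hC : TripleClosed n C)
    (hCn : C ⊆ treeSet n) (hg' : ConsistentOn p C g') (h : Splitting N W g x F s) (hF : F ⊆ C)
    (hg : ∀ f ∈ F, g' f = g f) : s = g' x := by
  induction h with
  | leaf _ => exact (hg _ rfl).symm
  | node hx h₁ h₂ ih₁ ih₂ =>
    have hF₁ := Set.subset_union_left.trans hF
    have hF₂ := Set.subset_union_right.trans hF
    rw [ih₁ hF₁ fun f hf => hg f (Or.inl hf), ih₂ hF₂ fun f hf => hg f (Or.inr hf)]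
    exact (hg' _ ((node hx h₁ h₂).head_mem hC hCn hF) (h₁.head_mem hC hCn hF₁)
      (h₂.head_mem hC hCn hF₂)).symm

theorem between {n : ℕ} {C : Set V} (hC : TripleClosed n C) (hCn : C ⊆ treeSet n)
    (h : Splitting N W g x F s) (hF : F ⊆ C) :
    ∀ f ∈ F, ∀ z : V, x <+: z → z <+: f → z ∈ C ∧ (z ∈ F ∨ z ∈ N) := by
  induction h with
  | leaf _ =>
    rintro f rfl z hxz hzf
    obtain rfl := hzf.eq_of_length_le hxz.length_le
    exact ⟨hF rfl, Or.inl rfl⟩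
  | @node x _ _ _ _ hx h₁ h₂ ih₁ ih₂ =>
    rintro f hf z hxz hzf
    by_cases hne : x = z
    · subst hne
      exact ⟨(node hx h₁ h₂).head_mem hC hCn hF, Or.inr hx⟩
    obtain ⟨b, hb⟩ := append_singleton_prefix_of_ne hxz hne
    rcases hf with hf | hf
    · obtain rfl := eq_of_append_singleton_prefix (h₁.prefix_of_mem f hf) (hb.trans hzf)
      exact (ih₁ (Set.subset_union_left.trans hF) f hf z hb hzf).imp_right (Or.imp_left Or.inl)
    · obtain rfl := eq_of_append_singleton_prefix (h₂.prefix_of_mem f hf) (hb.trans hzf)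
      exact (ih₂ (Set.subset_union_right.trans hF) f hf z hb hzf).imp_right (Or.imp_left Or.inr)

theorem length_le {n : ℕ} (hW : W ⊆ treeSet n) (h : Splitting N W g x F s) : x.length ≤ n := by
  obtain ⟨f, hf⟩ := h.nonempty
  exact (h.prefix_of_mem f hf).length_le.trans (hW (h.subset hf))

theorem encloses {n : ℕ} (hW : W ⊆ treeSet n) (h : Splitting N W g x F s) :
    Encloses n F x := by
  induction h with
  | leaf _ => exact fun l _ hl => ⟨_, rfl, List.prefix_refl _, hl⟩
  | @node x _ _ _ _ hx h₁ h₂ ih₁ ih₂ =>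
    intro l hln hl
    have hlen := h₁.length_le hW
    rw [List.length_append, List.length_singleton] at hlen
    obtain ⟨b, hb⟩ := append_singleton_prefix_of_ne hl (by rintro rfl; omega)
    cases b with
    | true =>
      obtain ⟨z, hz, hxz, hzl⟩ := ih₁ l hln hb
      exact ⟨z, Or.inl hz, (List.prefix_append _ _).trans hxz, hzl⟩
    | false =>
      obtain ⟨z, hz, hxz, hzl⟩ := ih₂ l hln hb
      exact ⟨z, Or.inr hz, (List.prefix_append _ _).trans hxz, hzl⟩

theorem minEncloses {n : ℕ} (hW : W ⊆ treeSet n) (h : Splitting N W g x F s) :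
    MinEncloses n F x := by
  refine ⟨h.encloses hW, fun F' hF' hE => ?_⟩
  obtain ⟨f, hf, hf'⟩ := Set.exists_of_ssubset hF'
  obtain ⟨l, hln, hfl⟩ := exists_leaf_extending (hW (h.subset hf))
  obtain ⟨z, hz, -, hzl⟩ := hE l hln ((h.prefix_of_mem f hf).trans hfl)
  rcases List.prefix_or_prefix_of_prefix hzl hfl with hzf | hfz
  · exact hf' (h.antichain z (hF'.1 hz) f hf hzf ▸ hz)
  · exact hf' (h.antichain f hf z (hF'.1 hz) hfz ▸ hz)

theorem sibling_mem {n : ℕ} (hW : W ⊆ treeSet n) (h : Splitting N W g x F s) {z f : V} {b : Bool}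
    (hz : z.length < n) (hxz : x <+: z) (hf : f ∈ F) (hzf : z ++ [b] <+: f) (c : Bool) :
    ∃ f' ∈ F, z ++ [c] <+: f' := by
  obtain ⟨l, hln, hl⟩ := exists_leaf_extending (n := n) (x := z ++ [c]) (by simpa using hz)
  obtain ⟨f', hf', -, hfl⟩ := h.encloses hW l hln (hxz.trans ((List.prefix_append _ _).trans hl))
  refine ⟨f', hf', ?_⟩
  rcases List.prefix_or_prefix_of_prefix hl hfl with h' | h'
  · exact h'
  rcases prefix_or_eq_append_singleton h' with h' | rfl
  · have := h.antichain f' hf' f hf (h'.trans ((List.prefix_append _ _).trans hzf))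
    subst this
    exact (not_append_singleton_prefix z b (hzf.trans h')).elim
  · exact List.prefix_refl _

theorem tripleClosed {n : ℕ} (hW : W ⊆ treeSet n) (h : Splitting N W g x F s) :
    TripleClosed n {z : V | ∃ f ∈ F, x <+: z ∧ z <+: f} := by
  refine fun z hz => ⟨?_, ?_, ?_⟩
  · rintro ⟨-, -, hxz, -⟩ ⟨f, hf, -, hzf⟩
    obtain ⟨f', hf', hzf'⟩ := h.sibling_mem hW hz hxz hf hzf false
    exact ⟨f', hf', hxz.trans (List.prefix_append _ _), hzf'⟩
  · rintro ⟨-, -, hxz, -⟩ ⟨f, hf, -, hzf⟩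
    obtain ⟨f', hf', hzf'⟩ := h.sibling_mem hW hz hxz hf hzf true
    exact ⟨f', hf', hxz.trans (List.prefix_append _ _), hzf'⟩
  · rintro ⟨f, hf, hx₁, hzf⟩ ⟨-, -, hx₂, -⟩
    refine ⟨f, hf, ?_, (List.prefix_append _ _).trans hzf⟩
    rcases prefix_or_eq_append_singleton hx₁ with hx | rfl
    · exact hx
    · cases eq_of_append_singleton_prefix hx₂ (List.prefix_refl _)

theorem conn : Conn {z : V | ∃ f ∈ F, x <+: z ∧ z <+: f} := by
  rintro a ⟨f, hf, hxa, haf⟩ b ⟨f', hf', hxb, hbf⟩ z ⟨hz | hz, hw⟩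
  · exact ⟨f, hf, hw x hxa hxb, hz.trans haf⟩
  · exact ⟨f', hf', hw x hxa hxb, hz.trans hbf⟩

theorem self_mem (h : Splitting N W g x F s) : x ∈ {z : V | ∃ f ∈ F, x <+: z ∧ z <+: f} := by
  obtain ⟨f, hf⟩ := h.nonempty
  exact ⟨f, hf, List.prefix_refl _, h.prefix_of_mem f hf⟩

theorem isHead (n : ℕ) (h : Splitting N W g x F s) :
    IsHead n {z : V | ∃ f ∈ F, x <+: z ∧ z <+: f} x := by
  refine ⟨h.self_mem, ?_⟩
  rintro y ⟨-, -, hxy, -⟩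
  exact Nat.sub_le_sub_left hxy.length_le n

theorem isFrontier {n : ℕ} (hW : W ⊆ treeSet n) (h : Splitting N W g x F s) :
    IsFrontier n {z : V | ∃ f ∈ F, x <+: z ∧ z <+: f} F x :=
  ⟨fun f hf => ⟨f, hf, h.prefix_of_mem f hf, List.prefix_refl _⟩, h.minEncloses hW, rfl⟩

theorem sum_unique (hg : ∀ x F s, x ∈ W → Splitting N W g x F s → s = g x)
    (h : Splitting N W g x F s) : ∀ {F' s'}, Splitting N W g x F' s' → s = s' := by
  induction h with
  | leaf hx => exact fun h' => (hg _ _ _ hx h').symm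
  | node hx h₁ h₂ ih₁ ih₂ =>
    intro F' s' h'
    cases h' with
    | leaf hx' => exact hg _ _ _ hx' (node hx h₁ h₂)
    | node _ h₁' h₂' => rw [ih₁ h₁', ih₂ h₂']

end Splitting

/-- `g` is consistent on `W` as soon as its value at every vertex of `W` equals its sum over
every subset of `W` into which that vertex splits. -/
theorem consistent_of_splitting {n p : ℕ} {W : Set V} {g : V → ZMod p}
    (hg : ∀ x F s, x ∈ W → Splitting Set.univ W g x F s → s = g x) : Consistent n p W g := by
  classical
  let D : Set V := {x | ∃ s F, Splitting Set.univ W g x F s}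
  let d : V → ZMod p := fun x => if hx : x ∈ D then hx.choose else 0
  have hd : ∀ {x F s}, Splitting Set.univ W g x F s → d x = s := by
    intro x F s h
    have hx : x ∈ D := ⟨s, F, h⟩
    obtain ⟨F', hF'⟩ := hx.choose_spec
    simp only [d, dif_pos hx]
    exact hF'.sum_unique hg h
  obtain ⟨f, hf, hfd⟩ := exists_additive_extension D d (by
    rintro x ⟨s₁, F₁, h₁⟩ ⟨s₂, F₂, h₂⟩
    have h := Splitting.node (Set.mem_univ x) h₁ h₂
    exact ⟨⟨_, _, h⟩, by rw [hd h, hd h₁, hd h₂]⟩)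
  refine ⟨f, fun x _ _ _ => hf x, fun x hx => ?_⟩
  have h : Splitting Set.univ W g x {x} (g x) := .leaf hx
  rw [hfd x ⟨_, _, h⟩, hd h]

/-- A splitting that passes through no vertex of `X` below its head respects `ρ ∪ 0`. -/
theorem Splitting.sum_eq_indicator {n p : ℕ} {X Y : Set V} (hXY : X ⊆ Y) (hY : Y ⊆ treeSet n)
    {ρ : V → ZMod p} (hρ : Consistent n p X ρ) {x : V} {F : Set V} {s : ZMod p}
    (hx : x ∈ X ∪ {y ∈ cl n Y | FreeOver n p X Y ρ y})
    (h : Splitting (insert x Xᶜ) (X ∪ {y ∈ cl n Y | FreeOver n p X Y ρ y}) (X.indicator ρ) x F s) :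
    s = X.indicator ρ x := by
  have hWY : X ∪ {y ∈ cl n Y | FreeOver n p X Y ρ y} ⊆ cl n Y :=
    Set.union_subset (hXY.trans (subset_cl n Y)) fun _ hy => hy.1
  have hYn := cl_subset_treeSet hY
  have hbetween := h.between (tripleClosed_cl n Y) hYn (h.subset.trans hWY)
  by_cases hX : insert x F ⊆ X
  · obtain ⟨hxX, hFX⟩ := Set.insert_subset_iff.1 hX
    obtain ⟨ρ', hρ', hext⟩ := hρ
    rw [Set.indicator_of_mem hxX, ← hext x hxX]
    refine h.sum_eq (tripleClosed_cl n X) (cl_subset_treeSet (hXY.trans hY)) hρ'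
      (hFX.trans (subset_cl n X)) fun f hf => ?_
    rw [Set.indicator_of_mem (hFX hf), hext f (hFX hf)]
  · obtain ⟨y, hy, hyX⟩ := Set.not_subset.1 hX
    have hyW := Set.insert_subset hx h.subset hy
    have hfree := (hyW.resolve_left hyX).2 _ x F
      (by rintro z ⟨f, hf, hxz, hzf⟩; exact (hbetween f hf z hxz hzf).1)
      ⟨x, h.self_mem⟩ (h.tripleClosed (hWY.trans hYn)) Splitting.conn (h.isHead n)
      (h.isFrontier (hWY.trans hYn)) hy
    rcases hfree with h0 | ⟨w, ⟨⟨f, hf, hxw, hwf⟩, hwX⟩, hw⟩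
    · have hg : ∀ z ∈ insert x F, X.indicator ρ z = 0 := fun z hz => by
        by_cases hzX : z ∈ X
        · rw [Set.indicator_of_mem hzX, h0 z ⟨hzX, hz⟩]
        · exact Set.indicator_of_notMem hzX ρ
      rw [h.sum_eq_zero fun f hf => hg f (Or.inr hf), hg x (Or.inl rfl)]
    · rcases (hbetween f hf w hxw hwf).2 with hwF | rfl | hwX'
      · exact (hw (Or.inr hwF)).elim
      · exact (hw (Or.inl rfl)).elim
      · exact (hwX' hwX).elim

/-- if `Z` is the set of elements of `cl(Y)` that are free
over the consistent function `ρ : X → Z/pZ` and `σ : Z → Z/pZ` is identically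
zero, then `ρ ∪ σ` (equal to `ρ` on `X` and `0` on `Z \ X`) is consistent. -/
theorem stmt_6 (n p : ℕ) (hp : p.Prime) (X Y : Set V) (hXY : X ⊆ Y)
    (hY : Y ⊆ treeSet n) (ρ : V → ZMod p) (hρ : Consistent n p X ρ) :
    Consistent n p (X ∪ {y ∈ cl n Y | FreeOver n p X Y ρ y}) (X.indicator ρ) := by
  refine consistent_of_splitting fun x F s hx h => ?_
  suffices H : (x ∈ X ∪ {y ∈ cl n Y | FreeOver n p X Y ρ y} → s = X.indicator ρ x) ∧
      ∃ F', Splitting Xᶜ (X ∪ {y ∈ cl n Y | FreeOver n p X Y ρ y}) (X.indicator ρ) x F' s from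
    H.1 hx
  clear hx
  induction h with
  | leaf hx => exact ⟨fun _ => rfl, _, .leaf hx⟩
  | @node x _ _ _ _ _ _ _ ih₁ ih₂ =>
    obtain ⟨-, F₁, h₁⟩ := ih₁
    obtain ⟨-, F₂, h₂⟩ := ih₂
    have hs := fun hx => Splitting.sum_eq_indicator hXY hY hρ hx
      (.node (Set.mem_insert x _) (h₁.mono (Set.subset_insert _ _))
        (h₂.mono (Set.subset_insert _ _)))
    refine ⟨hs, ?_⟩
    by_cases hxX : x ∈ X
    · rw [hs (Or.inl hxX)]
      exact ⟨_, .leaf (Or.inl hxX)⟩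
    · exact ⟨_, .node hxX h₁ h₂⟩
end

section
/- Let T = (V,E) be a finite complete rooted binary tree, p a prime, X ⊆ V, ρ : X → Z/pZ a consistent function, and Y_1, …, Y_r ⊆ V sets with |Y_i| ≤ s for all i. Then there exists a sequence of functions σ_i : Y_i → Z/pZ (1 ≤ i ≤ r) such that: (1) for each i with 1 ≤ i < r the functions ρ, σ_i, σ_{i+1} agree pairwise on common domains and their combined function ρ ∪ σ_i ∪ σ_{i+1} on X ∪ Y_i ∪ Y_{i+1} is consistent; and (2) for every i and every y ∈ Y_i with σ_i(y) ≠ 0, there exists some x ∈ X with ρ(x) ≠ 0 and hgt(y) ≥ hgt(x) − 2(|X| + s). -/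
open Classical in
/-- The combined function `ρ ∪ σ ∪ τ`, where `ρ` has domain `X`, `σ` has
domain `Y` and `τ` is used outside `X ∪ Y`. -/
noncomputable def comb3 (p : ℕ) (X Y : Set V) (ρ σ τ : V → ZMod p) : V → ZMod p :=
  fun v => if v ∈ X then ρ v else if v ∈ Y then σ v else τ v

/-- `f` satisfies the parent-equals-sum-of-children rule everywhere on the infinite binary tree. -/
def TreeAdditive {R : Type*} [Add R] (f : V → R) : Prop :=
  ∀ x : V, f x = f (x ++ [true]) + f (x ++ [false])

/-- The part of `Y` in the subtree of the child `b` of the root, with `b` stripped. -/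
noncomputable def childPart (b : Bool) (Y : Finset V) : Finset V :=
  Y.preimage (b :: ·) (List.cons_injective.injOn)

@[simp]
theorem mem_childPart {b : Bool} {Y : Finset V} {u : V} : u ∈ childPart b Y ↔ b :: u ∈ Y := by
  simp [childPart]

theorem card_image_cons_childPart (b : Bool) (Y : Finset V) :
    ((childPart b Y).image (b :: ·)).card = (childPart b Y).card :=
  Finset.card_image_of_injective _ List.cons_injective

theorem image_cons_childPart_subset (b : Bool) (Y : Finset V) :
    (childPart b Y).image (b :: ·) ⊆ Y := by
  intro y hy
  obtain ⟨u, hu, rfl⟩ := Finset.mem_image.1 hy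
  exact mem_childPart.1 hu

theorem card_childPart_le (b : Bool) (Y : Finset V) : (childPart b Y).card ≤ Y.card := by
  rw [← card_image_cons_childPart]
  exact Finset.card_le_card (image_cons_childPart_subset b Y)

/-- If the subtree of the child `b` carries all of `Y`, then `Y` lies in that subtree. -/
theorem exists_eq_cons_of_card_le {b : Bool} {Y : Finset V} (h : Y.card ≤ (childPart b Y).card)
    {y : V} (hy : y ∈ Y) : ∃ u ∈ childPart b Y, y = b :: u := by
  rw [← card_image_cons_childPart] at h
  rw [← Finset.eq_of_subset_of_card_le (image_cons_childPart_subset b Y) h] at hy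
  obtain ⟨u, hu, rfl⟩ := Finset.mem_image.1 hy
  exact ⟨u, hu, rfl⟩

/-- The function that is `f` on the subtree of the child `b`, zero on the other subtree, and
takes the value `f []` at the root. -/
def graft {R : Type*} [Zero R] (b : Bool) (f : V → R) : V → R
  | [] => f []
  | a :: u => if a = b then f u else 0

theorem TreeAdditive.graft {R : Type*} [AddCommMonoid R] {f : V → R} (hf : TreeAdditive f)
    (b : Bool) : TreeAdditive (graft b f) := by
  rintro (_ | ⟨a, u⟩)
  · cases b <;> simp [_root_.graft]
  · by_cases h : a = b
    · simpa [_root_.graft, h] using hf u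
    · simp [_root_.graft, h]

theorem TreeAdditive.cons {R : Type*} [Add R] {f : V → R} (hf : TreeAdditive f) (b : Bool) :
    TreeAdditive fun u => f (b :: u) :=
  fun x => hf (b :: x)

/-- The indicator function of the leftmost path from the root. -/
theorem exists_treeAdditive_nil_eq_one (R : Type*) [Ring R] :
    ∃ f : V → R, TreeAdditive f ∧ f [] = 1 := by
  refine ⟨fun u => if true ∈ u then 0 else 1, fun x => ?_, by simp⟩
  by_cases h : true ∈ x <;> simp [h]

/-- For every time `i`, `nx i` is the first label occurring strictly after `i`. -/
theorem exists_next_label {L : Type*} (lab : ℕ → Option L) :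
    ∃ nx : ℕ → Option L, ∀ i, nx i = (lab (i + 1)).or (nx (i + 1)) := by
  classical
  let S : ℕ → ℕ → Prop := fun i j => (lab (i + 1 + j)).isSome
  refine ⟨fun i => if h : ∃ j, S i j then lab (i + 1 + Nat.find h) else none, fun i => ?_⟩
  by_cases h0 : (lab (i + 1)).isSome
  · have h : ∃ j, S i j := ⟨0, h0⟩
    have hf : Nat.find h = 0 := (Nat.find_eq_zero h).2 h0
    obtain ⟨a, ha⟩ := Option.isSome_iff_exists.1 h0
    simp [h, hf, ha]
  · have hn : lab (i + 1) = none := by simpa using h0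
    have hS : ∀ j, S i (j + 1) ↔ S (i + 1) j := fun j => by
      simp only [S]
      rw [show i + 1 + (j + 1) = i + 1 + 1 + j by omega]
    rw [hn, Option.none_or]
    by_cases h : ∃ j, S (i + 1) j
    · have h' : ∃ j, S i j := ⟨_, (hS _).2 h.choose_spec⟩
      have hf : Nat.find h' = Nat.find h + 1 := by
        rw [Nat.find_eq_iff]
        refine ⟨(hS _).2 (Nat.find_spec h), ?_⟩
        rintro (_ | m) hm
        · exact h0
        · rw [hS]
          exact Nat.find_min h (by omega)
      simp only [dif_pos h, dif_pos h', hf]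
      congr 1
      omega
    · have h' : ¬ ∃ j, S i j := by
        rintro ⟨_ | j, hj⟩
        · exact h0 hj
        · exact h ⟨j, (hS j).1 hj⟩
      simp only [dif_neg h, dif_neg h']

/-- With four labels one can choose, over time, a label avoiding the marked one before and after
each step, and changing only at marked times. -/
theorem exists_avoiding_labels (lab : ℕ → Option (Bool × Bool)) :
    ∃ c : ℕ → Bool × Bool, ∀ i, lab i ≠ some (c i) ∧ lab (i + 1) ≠ some (c i) ∧
      (lab (i + 1) = none → c i = c (i + 1)) := by
  obtain ⟨nx, hnx⟩ := exists_next_label lab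
  have hpick : ∀ a b : Option (Bool × Bool), ∃ c, a ≠ some c ∧ b ≠ some c := by decide
  choose pick hp1 hp2 using hpick
  let ls : ℕ → Option (Bool × Bool) := fun i =>
    Nat.rec (lab 0) (fun j prev => (lab (j + 1)).or prev) i
  have hls : ∀ i a, lab i = some a → ls i = some a := by
    rintro (_ | i) a h
    · exact h
    · simp [ls, h]
  refine ⟨fun i => pick (ls i) (nx i), fun i => ⟨fun h => ?_, fun h => ?_, fun h => ?_⟩⟩
  · exact hp1 _ _ (hls _ _ h)
  · have hn : nx i = lab (i + 1) := by rw [hnx i, h, Option.some_or]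
    exact hp2 (ls i) (nx i) (hn.trans h)
  · have h1 : ls (i + 1) = ls i := by simp [ls, h]
    have h2 : nx i = nx (i + 1) := by rw [hnx i, h, Option.none_or]
    simp only [h1, h2]

/-- A unit of flow from the root can be rerouted over time so that sets of at most `k` observed
vertices never notice the rerouting and never see it below depth `2 * k`. -/
theorem exists_unit_flow (R : Type*) [Ring R] (k : ℕ) (Y : ℕ → Finset V)
    (hY : ∀ i, (Y i).card ≤ k) :
    ∃ μ : ℕ → V → R, ∀ i, TreeAdditive (μ i) ∧ μ i [] = 1 ∧
      (∀ y ∈ Y (i + 1), μ i y = μ (i + 1) y) ∧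
      ∀ y ∈ Y i ∪ Y (i + 1), μ i y ≠ 0 → y.length ≤ 2 * k := by
  classical
  induction k generalizing Y with
  | zero =>
    obtain ⟨f, hf, h1⟩ := exists_treeAdditive_nil_eq_one R
    have hY0 : ∀ i, Y i = ∅ := fun i => by simpa using hY i
    exact ⟨fun _ => f, fun i => ⟨hf, h1, by simp, by simp [hY0]⟩⟩
  | succ k ih =>
    let part : ℕ → Bool × Bool → Finset V := fun i c => childPart c.2 (childPart c.1 (Y i))
    let full : ℕ → Bool × Bool → Prop := fun i c => k < (part i c).card
    have hfull : ∀ i c, full i c → ∀ y ∈ Y i, ∃ u, y = c.1 :: c.2 :: u := by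
      intro i c hc y hy
      have h1 := card_childPart_le c.2 (childPart c.1 (Y i))
      have h2 := card_childPart_le c.1 (Y i)
      have h3 := hY i
      simp only [full, part] at hc
      obtain ⟨u, hu, rfl⟩ := exists_eq_cons_of_card_le (b := c.1) (by omega) hy
      obtain ⟨v, -, rfl⟩ := exists_eq_cons_of_card_le (b := c.2) (by omega) hu
      exact ⟨v, rfl⟩
    have hunique : ∀ i c e, full i c → full i e → c = e := by
      intro i c e hc he
      obtain ⟨u, hu⟩ : (part i c).Nonempty := Finset.card_pos.1 (by simp only [full] at hc; omega)
      obtain ⟨v, hv⟩ := hfull i e he (c.1 :: c.2 :: u) (by simpa [part] using hu)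
      simp only [List.cons.injEq] at hv
      exact Prod.ext hv.1 hv.2.1
    let lab : ℕ → Option (Bool × Bool) := fun i =>
      if h : ∃ c, full i c then some h.choose else none
    have hlab : ∀ i c, full i c → lab i = some c := by
      intro i c hc
      have h : ∃ c, full i c := ⟨c, hc⟩
      simp only [lab, dif_pos h, Option.some.injEq]
      exact hunique i _ _ h.choose_spec hc
    have hlab' : ∀ i c, lab i = some c → full i c := by
      intro i c hc
      by_cases h : ∃ c, full i c
      · simp only [lab, dif_pos h, Option.some.injEq] at hc
        exact hc ▸ h.choose_spec
      · simp only [lab, dif_neg h, reduceCtorEq] at hc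
    obtain ⟨c, hc⟩ := exists_avoiding_labels lab
    have hnf : ∀ i, ¬ full i (c i) := fun i h => (hc i).1 (hlab _ _ h)
    have hnf' : ∀ i, ¬ full (i + 1) (c i) := fun i h => (hc i).2.1 (hlab _ _ h)
    have hsub : ∀ e : Bool × Bool, ∀ i, (if full i e then ∅ else part i e).card ≤ k := by
      intro e i
      split_ifs with h
      · simp
      · simpa [full] using h
    choose ν hν using fun e : Bool × Bool => ih _ (hsub e)
    refine ⟨fun i => graft (c i).1 (graft (c i).2 (ν (c i) i)), fun i => ⟨?_, ?_, ?_, ?_⟩⟩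
    · exact ((hν (c i) i).1.graft _).graft _
    · exact (hν (c i) i).2.1
    · intro y hy
      cases hl : lab (i + 1) with
      | none =>
        simp only [← (hc i).2.2 hl]
        rcases y with _ | ⟨a, _ | ⟨b, u⟩⟩
        · simp [graft, (hν (c i) _).2.1]
        · simp [graft, (hν (c i) _).2.1]
        · simp only [graft]
          split_ifs with h1 h2
          · refine (hν (c i) i).2.2.1 u ?_
            rw [if_neg (hnf' i)]
            simpa [part, ← h1, ← h2] using hy
          · rfl
          · rfl
      | some e =>
        have he := hlab' _ _ hl
        obtain ⟨u, rfl⟩ := hfull _ _ he y hy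
        have hz : ∀ d : Bool × Bool, ¬ full (i + 1) d → ∀ f : V → R,
            graft d.1 (graft d.2 f) (e.1 :: e.2 :: u) = 0 := by
          intro d hd f
          have hne : ¬ (e.1 = d.1 ∧ e.2 = d.2) := fun h =>
            hd (Prod.ext h.1 h.2 ▸ he)
          simp only [graft]
          split_ifs with h1 h2
          · exact absurd ⟨h1, h2⟩ hne
          · rfl
          · rfl
        exact (hz _ (hnf' i) _).trans (hz _ (hnf (i + 1)) _).symm
    · intro y hy hne
      rcases y with _ | ⟨a, _ | ⟨b, u⟩⟩
      · simp
      · simp only [List.length_cons, List.length_nil]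
        omega
      · simp only [graft] at hne
        split_ifs at hne with h1 h2
        · have := (hν (c i) i).2.2.2 u (by
            rw [if_neg (hnf i), if_neg (hnf' i)]
            simpa [part, ← h1, ← h2] using hy) hne
          simp only [List.length_cons]
          omega
        all_goals exact absurd rfl hne

/-- A version of `exists_unit_flow` in which the flow avoids a set `X` on which some additive
function, nonzero at the root, vanishes. -/
theorem exists_unit_flow_avoiding {R : Type*} [Ring R] (s : ℕ) (X : Finset V) (g : V → R)
    (hg : TreeAdditive g) (h0 : g [] ≠ 0) (hX : ∀ x ∈ X, g x = 0) (Y : ℕ → Finset V)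
    (hY : ∀ i, (Y i).card ≤ s) :
    ∃ μ : ℕ → V → R, ∀ i, TreeAdditive (μ i) ∧ μ i [] = 1 ∧ (∀ x ∈ X, μ i x = 0) ∧
      (∀ y ∈ Y (i + 1), μ i y = μ (i + 1) y) ∧
      ∀ y ∈ Y i ∪ Y (i + 1), μ i y ≠ 0 → y.length ≤ X.card + 2 * s := by
  induction hm : X.card using Nat.strong_induction_on generalizing X g Y with
  | _ m ih =>
  subst hm
  have hYc : ∀ b i, (childPart b (Y i)).card ≤ s := fun b i =>
    (card_childPart_le b (Y i)).trans (hY i)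
  have hnil : [] ∉ X := fun h => h0 (hX _ h)
  have key : X.Nonempty → ∃ b, ∃ μ : ℕ → V → R, ∀ i, TreeAdditive (μ i) ∧ μ i [] = 1 ∧
      (∀ x ∈ childPart b X, μ i x = 0) ∧
      (∀ y ∈ childPart b (Y (i + 1)), μ i y = μ (i + 1) y) ∧
      ∀ y ∈ childPart b (Y i) ∪ childPart b (Y (i + 1)), μ i y ≠ 0 →
        y.length + 1 ≤ X.card + 2 * s := by
    intro hne
    obtain ⟨b, hb⟩ : ∃ b, g [b] ≠ 0 := by
      by_contra! h
      exact h0 (by rw [hg []]; simp [h])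
    by_cases hlt : (childPart b X).card < X.card
    · obtain ⟨μ, hμ⟩ := ih _ hlt (childPart b X) (fun u => g (b :: u)) (hg.cons b) hb
        (fun x hx => hX _ (mem_childPart.1 hx)) (fun i => childPart b (Y i)) (hYc b) rfl
      refine ⟨b, μ, fun i => ⟨(hμ i).1, (hμ i).2.1, (hμ i).2.2.1, (hμ i).2.2.2.1, ?_⟩⟩
      intro y hy h
      have := (hμ i).2.2.2.2 y hy h
      omega
    · obtain ⟨μ, hμ⟩ := exists_unit_flow R s (fun i => childPart (!b) (Y i)) (hYc _)
      refine ⟨!b, μ, fun i => ⟨(hμ i).1, (hμ i).2.1, ?_, (hμ i).2.2.1, ?_⟩⟩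
      · intro x hx
        obtain ⟨u, -, hu⟩ := exists_eq_cons_of_card_le (not_lt.1 hlt) (mem_childPart.1 hx)
        simp at hu
      · intro y hy h
        have := (hμ i).2.2.2 y hy h
        have := hne.card_pos
        omega
  rcases X.eq_empty_or_nonempty with rfl | hne
  · obtain ⟨μ, hμ⟩ := exists_unit_flow R s Y hY
    exact ⟨μ, fun i => ⟨(hμ i).1, (hμ i).2.1, by simp, (hμ i).2.2.1, by simpa using (hμ i).2.2.2⟩⟩
  obtain ⟨b, μ, hμ⟩ := key hne
  refine ⟨fun i => graft b (μ i), fun i => ⟨(hμ i).1.graft b, (hμ i).2.1, ?_, ?_, ?_⟩⟩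
  · rintro (_ | ⟨a, u⟩) hx
    · exact absurd hx hnil
    · simp only [graft]
      split_ifs with h
      · exact (hμ i).2.2.1 u (mem_childPart.2 (h ▸ hx))
      · rfl
  · rintro (_ | ⟨a, u⟩) hy
    · simp [graft, (hμ _).2.1]
    · simp only [graft]
      split_ifs with h
      · exact (hμ i).2.2.2.1 u (mem_childPart.2 (h ▸ hy))
      · rfl
  · rintro (_ | ⟨a, u⟩) hy h
    · simp
    · simp only [graft] at h
      split_ifs at h with hab
      · exact (hμ i).2.2.2.2 u (by simpa [hab] using hy) h
      · exact absurd rfl h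

/-- An additive function `g` whose nonzero values on `X` occur up to depth `d` can be modified
away from `X`, over time, so that small observed sets see no change and no nonzero value far
below depth `d`. -/
theorem exists_flow {R : Type*} [Ring R] (s d : ℕ) (X : Finset V) (g : V → R)
    (hg : TreeAdditive g) (hX : ∀ x ∈ X, g x ≠ 0 → x.length ≤ d) (Y : ℕ → Finset V)
    (hY : ∀ i, (Y i).card ≤ s) :
    ∃ τ : ℕ → V → R, ∀ i, TreeAdditive (τ i) ∧ τ i [] = g [] ∧ (∀ x ∈ X, τ i x = g x) ∧
      (∀ y ∈ Y (i + 1), τ i y = τ (i + 1) y) ∧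
      ∀ y ∈ Y i ∪ Y (i + 1), τ i y ≠ 0 → y.length ≤ d + X.card + 2 * s := by
  induction d generalizing X g Y with
  | zero =>
    by_cases h0 : g [] = 0
    · refine ⟨fun _ _ => 0, fun i => ⟨fun x => by simp, h0.symm, fun x hx => ?_, by simp, by simp⟩⟩
      by_contra h
      have hx0 : x = [] := by simpa using hX x hx (Ne.symm h)
      exact h (by rw [hx0, h0])
    · have hle : (X.erase []).card ≤ X.card := Finset.card_erase_le
      obtain ⟨μ, hμ⟩ := exists_unit_flow_avoiding s (X.erase []) g hg h0 (fun x hx => by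
        by_contra h
        exact Finset.ne_of_mem_erase hx (by simpa using hX x (Finset.mem_of_mem_erase hx) h)) Y hY
      refine ⟨fun i y => g [] * μ i y, fun i => ⟨fun x => ?_, ?_, fun x hx => ?_, fun y hy => ?_,
        fun y hy h => ?_⟩⟩
      · simp only []
        rw [(hμ i).1 x, mul_add]
      · simp [(hμ i).2.1]
      · by_cases hx0 : x = []
        · simp [hx0, (hμ i).2.1]
        · simp only []
          rw [(hμ i).2.2.1 x (Finset.mem_erase.2 ⟨hx0, hx⟩), mul_zero]
          by_contra h
          exact hx0 (by simpa using hX x hx (Ne.symm h))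
      · simp only []
        rw [(hμ i).2.2.2.1 y hy]
      · have := (hμ i).2.2.2.2 y hy (right_ne_zero_of_mul h)
        omega
  | succ d ih =>
    have key : ∀ b : Bool, _ := fun b => ih (childPart b X) (fun u => g (b :: u)) (hg.cons b)
      (fun x hx h => by simpa using hX _ (mem_childPart.1 hx) h) (fun i => childPart b (Y i))
      (fun i => (card_childPart_le b (Y i)).trans (hY i))
    choose ν hν using key
    let τ : ℕ → V → R := fun i y => match y with
      | [] => g []
      | b :: u => ν b i u
    refine ⟨τ, fun i => ⟨?_, rfl, ?_, ?_, ?_⟩⟩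
    · rintro (_ | ⟨b, u⟩)
      · simp only [τ, List.nil_append, (hν _ i).2.1]
        exact hg []
      · exact (hν b i).1 u
    · rintro (_ | ⟨b, u⟩) hx
      · rfl
      · exact (hν b i).2.2.1 u (mem_childPart.2 hx)
    · rintro (_ | ⟨b, u⟩) hy
      · rfl
      · exact (hν b i).2.2.2.1 u (mem_childPart.2 hy)
    · rintro (_ | ⟨b, u⟩) hy h
      · simp
      · have h1 := (hν b i).2.2.2.2 u (by simpa using hy) h
        have h2 := card_childPart_le b X
        simp only [List.length_cons]
        omega

open Classical in
/-- Top-down extension of a function `f` on `C` to the whole infinite tree, with value `a` at the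
root. -/
noncomputable def extendDown {R : Type*} [AddGroup R] : Set V → (V → R) → R → V → R
  | _, _, a, [] => a
  | C, f, a, b :: u => extendDown {v | b :: v ∈ C} (fun v => f (b :: v))
      (if [b] ∈ C then f [b] else if [!b] ∈ C then a - f [!b] else if b then a else 0) u

theorem extendDown_eq {R : Type*} [AddGroup R] (C : Set V) (f : V → R) (a : R)
    (ha : [] ∈ C → a = f []) (x : V) (hx : x ∈ C) : extendDown C f a x = f x := by
  induction x generalizing C f a with
  | nil => exact ha hx
  | cons b u ih =>
    rw [extendDown]
    exact ih _ _ _ (fun h => if_pos h) hx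

theorem treeAdditive_extendDown {R : Type*} [AddCommGroup R] (C : Set V) (f : V → R) (a : R)
    (ha : [] ∈ C → a = f [])
    (hup : ∀ x, x ++ [true] ∈ C → x ++ [false] ∈ C → x ∈ C)
    (hf : ∀ x, x ∈ C → x ++ [true] ∈ C → x ++ [false] ∈ C →
      f x = f (x ++ [true]) + f (x ++ [false])) :
    TreeAdditive (extendDown C f a) := by
  intro x
  induction x generalizing C f a with
  | nil =>
    simp only [List.nil_append, extendDown]
    by_cases h1 : [true] ∈ C <;> by_cases h2 : [false] ∈ C
    · have h := hup [] h1 h2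
      simpa [h1, h2, ha h] using hf [] h h1 h2
    · simp [h1, h2]
    · simp [h1, h2]
    · simp [h1, h2]
  | cons b u ih =>
    simp only [List.cons_append, extendDown]
    exact ih _ _ _ (fun h => if_pos h) (fun x => hup (b :: x)) (fun x => hf (b :: x))

theorem mem_cl_of_children_mem {n : ℕ} {X : Set V} (hX : X ⊆ treeSet n) {x : V}
    (h1 : x ++ [true] ∈ cl n X) (h2 : x ++ [false] ∈ cl n X) : x ∈ cl n X := by
  have hx : x.length < n := by
    have := cl_subset_treeSet hX h1
    simpa [treeSet] using this
  intro Z hZ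
  exact (hZ.2.2 x hx).2.2 (h1 Z hZ) (h2 Z hZ)

/-- A consistent function extends to an additive function on the infinite tree. -/
theorem Consistent.exists_treeAdditive {n p : ℕ} {X : Set V} {ρ : V → ZMod p}
    (hX : X ⊆ treeSet n) (h : Consistent n p X ρ) :
    ∃ g : V → ZMod p, TreeAdditive g ∧ ∀ x ∈ X, g x = ρ x := by
  obtain ⟨f, hf, hfX⟩ := h
  refine ⟨extendDown (cl n X) f (f []), treeAdditive_extendDown _ _ _ (fun _ => rfl)
    (fun x => mem_cl_of_children_mem hX) hf, fun x hx => ?_⟩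
  rw [extendDown_eq _ _ _ (fun _ => rfl) x (subset_cl n X hx), hfX x hx]

theorem TreeAdditive.consistent {n p : ℕ} {X : Set V} {ρ g : V → ZMod p} (hg : TreeAdditive g)
    (h : ∀ x ∈ X, g x = ρ x) : Consistent n p X ρ :=
  ⟨g, fun x _ _ _ => hg x, h⟩

theorem treeSet_finite (n : ℕ) : (treeSet n).Finite :=
  List.finite_length_le Bool n

/-- given a consistent `ρ : X → Z/pZ` and sets
`Y_1, …, Y_r ⊆ V` with `|Y_i| ≤ s`, there is a sequence of functions
`σ_i : Y_i → Z/pZ` such that (1) consecutive functions agree pairwise with each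
other and with `ρ` on common domains and `ρ ∪ σ_i ∪ σ_{i+1}` is consistent, and
(2) whenever `σ_i(y) ≠ 0` there is `x ∈ X` with `ρ(x) ≠ 0` and
`hgt(y) ≥ hgt(x) - 2(|X| + s)`. -/
theorem stmt_7 (n p s r : ℕ) (hp : p.Prime) (X : Set V) (hX : X ⊆ treeSet n)
    (ρ : V → ZMod p) (hρ : Consistent n p X ρ)
    (Y : Fin r → Set V) (hYtree : ∀ i, Y i ⊆ treeSet n)
    (hYs : ∀ i, (Y i).ncard ≤ s) :
    ∃ σ : Fin r → V → ZMod p,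
      (∀ i : Fin r, ∀ h : i.1 + 1 < r,
        (∀ x ∈ X ∩ Y i, σ i x = ρ x) ∧
        (∀ x ∈ X ∩ Y ⟨i.1 + 1, h⟩, σ ⟨i.1 + 1, h⟩ x = ρ x) ∧
        (∀ x ∈ Y i ∩ Y ⟨i.1 + 1, h⟩, σ i x = σ ⟨i.1 + 1, h⟩ x) ∧
        Consistent n p (X ∪ Y i ∪ Y ⟨i.1 + 1, h⟩)
          (comb3 p X (Y i) ρ (σ i) (σ ⟨i.1 + 1, h⟩))) ∧
      (∀ i : Fin r, ∀ y ∈ Y i, σ i y ≠ 0 →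
        ∃ x ∈ X, ρ x ≠ 0 ∧ hgt n x ≤ hgt n y + 2 * (X.ncard + s)) := by
  classical
  obtain ⟨g, hg, hgX⟩ := hρ.exists_treeAdditive hX
  have hXfin := (treeSet_finite n).subset hX
  have hYfin := fun i => (treeSet_finite n).subset (hYtree i)
  let Y' : ℕ → Finset V := fun i => if h : i < r then (hYfin ⟨i, h⟩).toFinset else ∅
  have hmem : ∀ i : Fin r, ∀ y, y ∈ Y' i ↔ y ∈ Y i := fun i y => by simp [Y']
  have hcard : ∀ i, (Y' i).card ≤ s := by
    intro i
    by_cases h : i < r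
    · simpa [Y', h, Set.ncard_eq_toFinset_card _ (hYfin ⟨i, h⟩)] using hYs ⟨i, h⟩
    · simp [Y', h]
  have hXcard : hXfin.toFinset.card = X.ncard := (Set.ncard_eq_toFinset_card _ hXfin).symm
  suffices H : ∃ τ : ℕ → V → ZMod p, ∀ i, TreeAdditive (τ i) ∧ (∀ x ∈ X, τ i x = ρ x) ∧
      (∀ y ∈ Y' (i + 1), τ i y = τ (i + 1) y) ∧
      ∀ y ∈ Y' i, τ i y ≠ 0 → ∃ x ∈ X, ρ x ≠ 0 ∧ hgt n x ≤ hgt n y + 2 * (X.ncard + s) by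
    obtain ⟨τ, hτ⟩ := H
    refine ⟨fun i => τ i, fun i h => ⟨fun x hx => (hτ _).2.1 x hx.1, fun x hx => (hτ _).2.1 x hx.1,
      fun x hx => (hτ i).2.2.1 x ((hmem ⟨i + 1, h⟩ x).2 hx.2), (hτ i).1.consistent ?_⟩,
      fun i y hy => (hτ i).2.2.2 y ((hmem i y).2 hy)⟩
    intro x hx
    simp only [comb3]
    split_ifs with h1 h2
    · exact (hτ i).2.1 x h1
    · rfl
    · have hx' : x ∈ Y ⟨i + 1, h⟩ := by
        rcases hx with (hx | hx) | hx
        · exact absurd hx h1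
        · exact absurd hx h2
        · exact hx
      exact (hτ i).2.2.1 x ((hmem ⟨i + 1, h⟩ x).2 hx')
  by_cases hz : ∃ x ∈ X, ρ x ≠ 0
  · obtain ⟨x₀, hx₀, hmax⟩ := (hXfin.toFinset.filter fun x => ρ x ≠ 0).exists_max_image
      List.length (by
        obtain ⟨x, hx, h⟩ := hz
        exact ⟨x, by simp [hx, h]⟩)
    simp only [Finset.mem_filter, Set.Finite.mem_toFinset] at hx₀ hmax
    obtain ⟨τ, hτ⟩ := exists_flow s x₀.length hXfin.toFinset g hg (fun x hx h => by
      rw [Set.Finite.mem_toFinset] at hx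
      exact hmax x ⟨hx, hgX x hx ▸ h⟩) Y' hcard
    refine ⟨τ, fun i => ⟨(hτ i).1, fun x hx => ?_, (hτ i).2.2.2.1, fun y hy h => ?_⟩⟩
    · rw [(hτ i).2.2.1 x (hXfin.mem_toFinset.2 hx), hgX x hx]
    · have := (hτ i).2.2.2.2 y (Finset.mem_union_left _ hy) h
      refine ⟨x₀, hx₀.1, hx₀.2, ?_⟩
      rw [hXcard] at this
      simp only [hgt]
      omega
  · push Not at hz
    exact ⟨fun _ _ => 0, fun i => ⟨fun x => by simp, fun x hx => (hz x hx).symm, by simp, by simp⟩⟩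
end
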